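/- Let ν > 0, let θ : ℤ²₀ → ℝ be not identically zero, have finite support and be radially symmetric, and set ε = 2√ν / ‖θ‖_{ℓ²}. Then for all x, y ∈ 𝕋², the operator norm of the 2×2 matrix Q(x,y) = ∑_{k ∈ ℤ²₀} θ_k² σ_k(x) ⊗ σ_k(y) is at most (1/2) ‖θ‖²_{ℓ²}, and consequently ε² |Q(x,y)| ≤ 2ν. -/

import Mathlib

open MeasureTheory Real Filter
open scoped Classical

noncomputable section

abbrev T2 : Type := AddCircle (1:ℝ) × AddCircle (1:ℝ)

/-- cos(2π k·x) on the 2D torus. -/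
def tCos (k : ℤ × ℤ) (x : T2) : ℝ := (fourier k.1 x.1 * fourier k.2 x.2).re

/-- sin(2π k·x) on the 2D torus. -/
def tSin (k : ℤ × ℤ) (x : T2) : ℝ := (fourier k.1 x.1 * fourier k.2 x.2).im

/-- The trigonometric basis functions e_k on the torus. -/
def eFun (k : ℤ × ℤ) (x : T2) : ℝ :=
  if k = 0 then 1
  else if 0 < k.1 ∨ (k.1 = 0 ∧ 0 < k.2) then Real.sqrt 2 * tCos k x
  else Real.sqrt 2 * tSin k x

/-- |k| for k ∈ ℤ². -/
def knorm (k : ℤ × ℤ) : ℝ := Real.sqrt ((k.1:ℝ)^2 + (k.2:ℝ)^2)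

/-- k⊥ = (k₂, -k₁). -/
def kperp (k : ℤ × ℤ) : Fin 2 → ℝ := ![(k.2:ℝ), -(k.1:ℝ)]

/-- The divergence-free vector fields σ_k(x) = (k⊥/|k|) e_k(x). -/
def sigmaV (k : ℤ × ℤ) (x : T2) : Fin 2 → ℝ := fun i => kperp k i / knorm k * eFun k x

/-- θ is radially symmetric: θ_k = θ_j whenever |k| = |j|. -/
def Radial (θ : ℤ × ℤ → ℝ) : Prop := ∀ k j : ℤ × ℤ, knorm k = knorm j → θ k = θ j

/-- The (Euclidean) operator norm of a 2×2 real matrix. -/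
def opNorm2 (M : Matrix (Fin 2) (Fin 2) ℝ) : ℝ :=
  ‖LinearMap.toContinuousLinearMap (Matrix.toEuclideanLin M)‖

theorem eFun_sq_add_eFun_neg_sq {k : ℤ × ℤ} (hk : k ≠ 0) (x : T2) :
    eFun k x ^ 2 + eFun (-k) x ^ 2 = 2 := by
  have h2 : √(2:ℝ) ^ 2 = 2 := Real.sq_sqrt (by norm_num)
  have hcos : tCos (-k) x = tCos k x := by
    simp only [tCos, Prod.fst_neg, Prod.snd_neg, fourier_neg, ← map_mul, Complex.conj_re]
  have hsin : tSin (-k) x = -tSin k x := by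
    simp only [tSin, Prod.fst_neg, Prod.snd_neg, fourier_neg, ← map_mul, Complex.conj_im]
  have hsum : tCos k x ^ 2 + tSin k x ^ 2 = 1 := by
    have h : Complex.normSq (fourier k.1 x.1 * fourier k.2 x.2) = 1 := by
      simp only [Complex.normSq_eq_norm_sq, fourier_apply, norm_mul, Circle.norm_coe]
      norm_num
    rw [Complex.normSq_apply] at h
    simp only [tCos, tSin]
    linarith
  have hk' : -k ≠ 0 := neg_ne_zero.mpr hk
  have hor : k.1 ≠ 0 ∨ k.2 ≠ 0 := by
    by_contra! h
    exact hk (Prod.ext h.1 h.2)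
  by_cases hp : 0 < k.1 ∨ (k.1 = 0 ∧ 0 < k.2)
  · have hn : ¬ (0 < (-k).1 ∨ ((-k).1 = 0 ∧ 0 < (-k).2)) := by
      simp only [Prod.fst_neg, Prod.snd_neg]; omega
    simp only [eFun, if_neg hk, if_neg hk', if_pos hp, if_neg hn, hsin, mul_pow, neg_sq, h2]
    linarith
  · have hn : 0 < (-k).1 ∨ ((-k).1 = 0 ∧ 0 < (-k).2) := by
      simp only [Prod.fst_neg, Prod.snd_neg]; omega
    simp only [eFun, if_neg hk, if_neg hk', if_neg hp, if_pos hn, hcos, mul_pow, h2]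
    linarith

/-- Rotation of the lattice `ℤ²` by a quarter turn. -/
def quarterTurn : ℤ × ℤ ≃ ℤ × ℤ where
  toFun k := (k.2, -k.1)
  invFun k := (-k.2, k.1)
  left_inv k := by simp
  right_inv k := by simp

theorem knorm_quarterTurn (k : ℤ × ℤ) : knorm (quarterTurn k) = knorm k := by
  simp [knorm, quarterTurn, add_comm]

theorem quarterTurn_quarterTurn (k : ℤ × ℤ) : quarterTurn (quarterTurn k) = -k := by
  simp [quarterTurn, Prod.ext_iff]

theorem knorm_sq_pos {k : ℤ × ℤ} (hk : k ≠ 0) : 0 < (k.1:ℝ) ^ 2 + (k.2:ℝ) ^ 2 := by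
  have hor : k.1 ≠ 0 ∨ k.2 ≠ 0 := by
    by_contra! h
    exact hk (Prod.ext h.1 h.2)
  rcases hor with h | h
  · have : (k.1:ℝ) ≠ 0 := by exact_mod_cast h
    positivity
  · have : (k.2:ℝ) ≠ 0 := by exact_mod_cast h
    positivity

theorem dotProduct_sigmaV_sq_add_neg {k : ℤ × ℤ} (hk : k ≠ 0) (x : T2) (u : Fin 2 → ℝ) :
    (sigmaV k x ⬝ᵥ u) ^ 2 + (sigmaV (-k) x ⬝ᵥ u) ^ 2 =
      2 * (k.2 * u 0 - k.1 * u 1) ^ 2 / ((k.1:ℝ) ^ 2 + (k.2:ℝ) ^ 2) := by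
  have hpos := knorm_sq_pos hk
  have hn : knorm (-k) = knorm k := by simp [knorm]
  have hsq : knorm k ^ 2 = (k.1:ℝ) ^ 2 + (k.2:ℝ) ^ 2 := Real.sq_sqrt hpos.le
  have h1 : sigmaV k x ⬝ᵥ u = (k.2 * u 0 - k.1 * u 1) / knorm k * eFun k x := by
    simp [sigmaV, kperp, dotProduct, Fin.sum_univ_two]; ring
  have h2 : sigmaV (-k) x ⬝ᵥ u = -((k.2 * u 0 - k.1 * u 1) / knorm k * eFun (-k) x) := by
    simp [sigmaV, kperp, dotProduct, Fin.sum_univ_two, hn]; ring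
  rw [h1, h2, neg_sq, mul_pow, mul_pow, ← mul_add, eFun_sq_add_eFun_neg_sq hk, div_pow, hsq]
  ring

theorem dotProduct_sigmaV_sq_add_orbit {k : ℤ × ℤ} (hk : k ≠ 0) (x : T2) (u : Fin 2 → ℝ) :
    (sigmaV k x ⬝ᵥ u) ^ 2 + (sigmaV (-k) x ⬝ᵥ u) ^ 2 +
      ((sigmaV (quarterTurn k) x ⬝ᵥ u) ^ 2 + (sigmaV (-quarterTurn k) x ⬝ᵥ u) ^ 2) =
      2 * (u ⬝ᵥ u) := by
  have hpos := knorm_sq_pos hk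
  have hk' : quarterTurn k ≠ 0 := fun h => hk (quarterTurn.injective (h.trans (by rfl)))
  rw [dotProduct_sigmaV_sq_add_neg hk, dotProduct_sigmaV_sq_add_neg hk']
  simp only [quarterTurn, Equiv.coe_fn_mk, Int.cast_neg, neg_sq, dotProduct, Fin.sum_univ_two]
  rw [add_comm ((k.2:ℝ) ^ 2), ← add_div, div_eq_iff hpos.ne']
  ring

/-- The quadratic form `u ↦ ∑ θ_k² (σ_k(x) · u)²` is `½ ‖θ‖² |u|²`. -/
theorem sum_sq_mul_dotProduct_sigmaV_sq {θ : ℤ × ℤ → ℝ} (hfin : (Function.support θ).Finite)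
    (hzero : θ 0 = 0) (hrad : Radial θ) (x : T2) (u : Fin 2 → ℝ) :
    ∑ k ∈ hfin.toFinset, θ k ^ 2 * (sigmaV k x ⬝ᵥ u) ^ 2 =
      1 / 2 * (∑ k ∈ hfin.toFinset, θ k ^ 2) * (u ⬝ᵥ u) := by
  have hθ (k : ℤ × ℤ) : θ (quarterTurn k) = θ k := hrad _ _ (knorm_quarterTurn k)
  have turn (f : ℤ × ℤ → ℝ) : ∑ k ∈ hfin.toFinset, θ k ^ 2 * f (quarterTurn k) =
      ∑ k ∈ hfin.toFinset, θ k ^ 2 * f k :=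
    Finset.sum_equiv quarterTurn (by simp [hθ]) (by simp [hθ])
  set f : ℤ × ℤ → ℝ := fun k => (sigmaV k x ⬝ᵥ u) ^ 2 with hf
  have hneg (g : ℤ × ℤ → ℝ) : ∑ k ∈ hfin.toFinset, θ k ^ 2 * g (-k) =
      ∑ k ∈ hfin.toFinset, θ k ^ 2 * g k := by
    simp only [← quarterTurn_quarterTurn]
    rw [turn fun k => g (quarterTurn k), turn]
  have horbit : ∑ k ∈ hfin.toFinset, θ k ^ 2 *
      (f k + f (-k) + (f (quarterTurn k) + f (-quarterTurn k))) =
      ∑ k ∈ hfin.toFinset, θ k ^ 2 * (2 * (u ⬝ᵥ u)) := by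
    refine Finset.sum_congr rfl fun k hk => ?_
    have hk0 : k ≠ 0 := by
      rintro rfl
      simp [hzero] at hk
    rw [hf, dotProduct_sigmaV_sq_add_orbit hk0]
  simp only [mul_add, Finset.sum_add_distrib] at horbit
  rw [turn f, turn fun k => f (-k), hneg, ← Finset.sum_mul] at horbit
  linarith

theorem opNorm2_le_of_dotProduct_le {M : Matrix (Fin 2) (Fin 2) ℝ} {C : ℝ} (hC : 0 ≤ C)
    (h : ∀ v, (M.mulVec v) ⬝ᵥ (M.mulVec v) ≤ C ^ 2 * (v ⬝ᵥ v)) : opNorm2 M ≤ C := by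
  refine ContinuousLinearMap.opNorm_le_bound _ hC fun v => ?_
  refine (sq_le_sq₀ (norm_nonneg _) (by positivity)).mp ?_
  have hv := h v.ofLp
  simp only [dotProduct, ← sq] at hv
  simpa [mul_pow, EuclideanSpace.norm_sq_eq, Matrix.toLpLin_apply] using hv

/-- Cauchy–Schwarz bound for a weighted sum of rank-one matrices. -/
theorem opNorm2_sum_smul_vecMulVec_le {ι : Type*} (s : Finset ι) (θ : ι → ℝ)
    (a b : ι → Fin 2 → ℝ) {C : ℝ} (hC : 0 ≤ C)
    (ha : ∀ u, ∑ k ∈ s, θ k ^ 2 * (a k ⬝ᵥ u) ^ 2 ≤ C * (u ⬝ᵥ u))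
    (hb : ∀ u, ∑ k ∈ s, θ k ^ 2 * (b k ⬝ᵥ u) ^ 2 ≤ C * (u ⬝ᵥ u)) :
    opNorm2 (∑ k ∈ s, θ k ^ 2 • Matrix.vecMulVec (a k) (b k)) ≤ C := by
  refine opNorm2_le_of_dotProduct_le hC fun v => ?_
  set w := (∑ k ∈ s, θ k ^ 2 • Matrix.vecMulVec (a k) (b k)).mulVec v with hw
  have hww : w ⬝ᵥ w = ∑ k ∈ s, (θ k * (a k ⬝ᵥ w)) * (θ k * (b k ⬝ᵥ v)) := by
    conv_lhs => enter [1]; rw [hw]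
    rw [Matrix.sum_mulVec, sum_dotProduct]
    refine Finset.sum_congr rfl fun k _ => ?_
    rw [Matrix.smul_mulVec, Matrix.vecMulVec_mulVec, smul_dotProduct]
    simp
    ring
  have hcs := Finset.sum_mul_sq_le_sq_mul_sq s (fun k => θ k * (a k ⬝ᵥ w))
    (fun k => θ k * (b k ⬝ᵥ v))
  simp only [mul_pow] at hcs
  rw [← hww] at hcs
  have hwn : 0 ≤ w ⬝ᵥ w := by simpa using dotProduct_star_self_nonneg w
  have hmul := hcs.trans (mul_le_mul (ha w) (hb v) (by positivity) (by positivity))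
  rcases hwn.eq_or_lt with h0 | hpos
  · rw [← h0]
    have : 0 ≤ v ⬝ᵥ v := by simpa using dotProduct_star_self_nonneg v
    positivity
  · refine le_of_mul_le_mul_left ?_ hpos
    linarith

/-- With `ε = 2√ν/‖θ‖_{ℓ²}`, for all `x, y ∈ 𝕋²` the operator norm of
`Q(x,y) = ∑_k θ_k² σ_k(x) ⊗ σ_k(y)` is at most `(1/2)‖θ‖²_{ℓ²}`, hence `ε²|Q(x,y)| ≤ 2ν`. -/
theorem statement3 (ν : ℝ) (hν : 0 < ν) (θ : ℤ × ℤ → ℝ) (hne : θ ≠ 0)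
    (hfin : (Function.support θ).Finite) (hzero : θ 0 = 0) (hrad : Radial θ)
    (ε : ℝ) (hε : ε = 2 * Real.sqrt ν / Real.sqrt (∑ᶠ k : ℤ × ℤ, (θ k) ^ 2))
    (x y : T2) :
    opNorm2 (∑ᶠ k : ℤ × ℤ, (θ k) ^ 2 • Matrix.vecMulVec (sigmaV k x) (sigmaV k y))
      ≤ (1 / 2 : ℝ) * ∑ᶠ k : ℤ × ℤ, (θ k) ^ 2 ∧
    ε ^ 2 * opNorm2 (∑ᶠ k : ℤ × ℤ, (θ k) ^ 2 • Matrix.vecMulVec (sigmaV k x) (sigmaV k y))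
      ≤ 2 * ν := by
  have hsub : Function.support (fun k => θ k ^ 2) ⊆ hfin.toFinset := fun k hk => by
    simpa using hk
  have hsubQ : Function.support
      (fun k => θ k ^ 2 • Matrix.vecMulVec (sigmaV k x) (sigmaV k y)) ⊆ hfin.toFinset := by
    intro k hk
    simp only [Set.Finite.coe_toFinset, Function.mem_support] at hk ⊢
    rintro h
    simp [h] at hk
  rw [finsum_eq_sum_of_support_subset _ hsub] at hε ⊢
  rw [finsum_eq_sum_of_support_subset _ hsubQ]
  set S := ∑ k ∈ hfin.toFinset, θ k ^ 2 with hS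
  have hSpos : 0 < S := by
    obtain ⟨k, hk⟩ := Function.ne_iff.mp hne
    have hk' : θ k ≠ 0 := hk
    exact Finset.sum_pos' (fun _ _ => sq_nonneg _) ⟨k, by simpa using hk', by positivity⟩
  have hQ : opNorm2 (∑ k ∈ hfin.toFinset,
      θ k ^ 2 • Matrix.vecMulVec (sigmaV k x) (sigmaV k y)) ≤ 1 / 2 * S :=
    opNorm2_sum_smul_vecMulVec_le _ θ _ _ (by positivity)
      (fun u => (sum_sq_mul_dotProduct_sigmaV_sq hfin hzero hrad x u).le)
      (fun u => (sum_sq_mul_dotProduct_sigmaV_sq hfin hzero hrad y u).le)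
  refine ⟨hQ, (mul_le_mul_of_nonneg_left hQ (sq_nonneg ε)).trans (le_of_eq ?_)⟩
  rw [hε, div_pow, mul_pow, Real.sq_sqrt hν.le, Real.sq_sqrt hSpos.le]
  field_simp
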